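/- Let V ∈ ℝ^{C×D} be an arbitrary matrix, a ∈ ℝ^C, and x' ∈ ℝ^D with x'_d ≠ 0. Then the network's predictive distribution converges to a fixed output along the scaled ray: there exists p ∈ ℝ^C such that softmax(V x_α + a) → p (componentwise) as α → ∞. -/

import Mathlib

/-- The softmax function on `ℝ^C`. -/
noncomputable def softmax {C : ℕ} (z : Fin C → ℝ) : Fin C → ℝ :=
  fun c => Real.exp (z c) / ∑ c', Real.exp (z c')

/-- The point `x'` scaled by `α` in coordinate `d` (all other coordinates unchanged). -/
def scaled {D : ℕ} (x' : Fin D → ℝ) (d : Fin D) (α : ℝ) : Fin D → ℝ :=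
  Function.update x' d (α * x' d)

/-- Softmax is invariant under subtracting a constant from every logit. -/
theorem softmax_sub_const {C : ℕ} (z : Fin C → ℝ) (t : ℝ) :
    softmax (fun c => z c - t) = softmax z := by
  funext c
  simp only [softmax, Real.exp_sub, ← Finset.sum_div]
  exact div_div_div_cancel_right₀ (Real.exp_ne_zero t) _ _

theorem mulVec_scaled {C D : ℕ} (V : Matrix (Fin C) (Fin D) ℝ) (x : Fin D → ℝ) (d : Fin D)
    (α : ℝ) (c : Fin C) :
    V.mulVec (scaled x d α) c = α * (V c d * x d) + V.mulVec (Function.update x d 0) c := by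
  have h : scaled x d α = Pi.single d (α * x d) + Function.update x d 0 := by
    funext i
    by_cases hi : i = d
    · subst hi; simp [scaled]
    · simp [scaled, hi]
  rw [h, Matrix.mulVec_add, Pi.add_apply, Matrix.mulVec_single]
  simp [Matrix.col_apply]
  ring

theorem tendsto_exp_mul_add_atTop {s : ℝ} (hs : s ≤ 0) (b : ℝ) :
    Filter.Tendsto (fun α : ℝ => Real.exp (α * s + b)) Filter.atTop
      (nhds (if s = 0 then Real.exp b else 0)) := by
  split_ifs with h
  · simp [h]
  · exact Real.tendsto_exp_atBot.comp (Filter.tendsto_atBot_add_const_right _ b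
      (Filter.tendsto_id.atTop_mul_const_of_neg (lt_of_le_of_ne hs h)))

/-- Along an affine ray of logits, softmax converges, with limit supported on the logits of
maximal slope. -/
theorem exists_tendsto_softmax_affine {C : ℕ} [NeZero C] (s b : Fin C → ℝ) :
    ∃ p : Fin C → ℝ, ∀ c, Filter.Tendsto (fun α : ℝ => softmax (fun i => α * s i + b i) c)
      Filter.atTop (nhds (p c)) := by
  obtain ⟨m, hm⟩ := Finite.exists_max s
  have hlim (i : Fin C) := tendsto_exp_mul_add_atTop (sub_nonpos.2 (hm i)) (b i)
  have hpos : 0 < ∑ i, if s i - s m = 0 then Real.exp (b i) else 0 :=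
    Finset.sum_pos' (fun i _ => by split_ifs <;> positivity)
      ⟨m, Finset.mem_univ m, by simp [Real.exp_pos]⟩
  refine ⟨_, fun c => ((hlim c).div (tendsto_finsetSum _ fun i _ => hlim i) hpos.ne').congr
    fun α => ?_⟩
  rw [← softmax_sub_const _ (α * s m)]
  simp only [softmax, Pi.div_apply]
  ring_nf

theorem stmt_15 (D C : ℕ) (hC : 1 ≤ C)
    (V : Matrix (Fin C) (Fin D) ℝ) (a : Fin C → ℝ) (d : Fin D)
    (x' : Fin D → ℝ) (hx' : x' d ≠ 0) :
    ∃ p : Fin C → ℝ,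
      ∀ c : Fin C,
        Filter.Tendsto (fun α : ℝ => softmax (V.mulVec (scaled x' d α) + a) c)
          Filter.atTop (nhds (p c)) := by
  have : NeZero C := ⟨by lia⟩
  obtain ⟨p, hp⟩ := exists_tendsto_softmax_affine (fun c => V c d * x' d)
    (V.mulVec (Function.update x' d 0) + a)
  refine ⟨p, fun c => (hp c).congr fun α => ?_⟩
  congr 1
  funext i
  simp only [Pi.add_apply, mulVec_scaled]
  ring
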